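/- Let Γ = {1324, 1423}. Then U_{Γ,1}(y) = −y, and for all n ≥ 2, U_{Γ,n}(y) = (1−y)·U_{Γ,n−1}(y) − y·(n−2)·( U_{Γ,n−2}(y) + y·U_{Γ,n−3}(y) ). -/

import Mathlib

open Polynomial

/-- The reduction of a list of distinct integers: replace the i-th smallest entry by i. -/
def redL (l : List ℕ) : List ℕ :=
  l.map (fun x => (l.countP (fun y => decide (y < x))) + 1)

/-- The number of descents of a list. -/
def desL (l : List ℕ) : ℕ :=
  (l.zip l.tail).countP (fun p => decide (p.2 < p.1))

/-- `σ` has a `Γ`-match: some consecutive factor of length at least 2 reduces to a member of `Γ`. -/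
def HasMatch (Γ : Set (List ℕ)) (l : List ℕ) : Prop :=
  ∃ i j : ℕ, 1 ≤ j ∧ i + j + 1 ≤ l.length ∧ redL ((l.drop i).take (j + 1)) ∈ Γ

open scoped Classical in
/-- The set of permutations of `{1,…,n}` (in one-line notation, as lists) with no `Γ`-match. -/
noncomputable def NMfinset (Γ : Set (List ℕ)) (n : ℕ) : Finset (List ℕ) :=
  ((List.range' 1 n).permutations.toFinset).filter (fun l => ¬ HasMatch Γ l)

/-- `NM_{Γ,n}(y) = Σ_{σ ∈ NM_n(Γ)} y^{1+des(σ)}` for `n ≥ 1`, and `NM_{Γ,0}(y) = 1`. -/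
noncomputable def NMpoly (Γ : Set (List ℕ)) (n : ℕ) : Polynomial ℚ :=
  if n = 0 then 1 else ∑ l ∈ NMfinset Γ n, X ^ (1 + desL l)


/-- The list starts with a window matching one of the two patterns. -/
def startM : List ℕ → Prop
  | a :: b :: c :: d :: _ => a < c ∧ c < b ∧ c < d
  | _ => False

def badL : List ℕ → Prop
  | [] => False
  | a :: l => startM (a :: l) ∨ badL l

def downUp : List ℕ → Prop
  | a :: b :: c :: _ => b < a ∧ b < c
  | _ => False

theorem redL_four (a b c d : ℕ) (h : [a, b, c, d].Nodup) :
    redL [a, b, c, d] ∈ ({[1, 3, 2, 4], [1, 4, 2, 3]} : Set (List ℕ)) ↔ a < c ∧ c < b ∧ c < d := by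
  simp only [List.nodup_cons, List.mem_cons, not_or] at h
  simp [redL, List.countP_cons]
  grind

theorem redL_len (l : List ℕ) (h : redL l ∈ ({[1, 3, 2, 4], [1, 4, 2, 3]} : Set (List ℕ))) :
    l.length = 4 := by
  have : (redL l).length = l.length := by simp [redL]
  rcases h with h | h <;> rw [← this, h] <;> rfl

theorem startM_iff (l : List ℕ) (h : l.Nodup) :
    startM l ↔ 4 ≤ l.length ∧
      redL (l.take 4) ∈ ({[1, 3, 2, 4], [1, 4, 2, 3]} : Set (List ℕ)) := by
  match l with
  | [] => simp [startM]
  | [_] => simp [startM]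
  | [_, _] => simp [startM]
  | [_, _, _] => simp [startM]
  | a :: b :: c :: d :: l =>
    have h4 : [a, b, c, d].Nodup := by
      refine h.sublist (List.Sublist.cons_cons _ (List.Sublist.cons_cons _
        (List.Sublist.cons_cons _ (List.Sublist.cons_cons _ (List.nil_sublist _)))))
    have := redL_four a b c d h4
    simp only [startM, List.take_succ_cons, List.take_zero, this]
    simp

theorem hasMatch_iff (l : List ℕ) (h : l.Nodup) :
    HasMatch {[1, 3, 2, 4], [1, 4, 2, 3]} l ↔ badL l := by
  have key : HasMatch {[1, 3, 2, 4], [1, 4, 2, 3]} l ↔ ∃ i, startM (l.drop i) := by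
    constructor
    · rintro ⟨i, j, hj, hl, hr⟩
      have h4 := redL_len _ hr
      rw [List.length_take, List.length_drop] at h4
      have : j = 3 := by omega
      subst this
      refine ⟨i, (startM_iff _ (h.sublist (List.drop_sublist _ _))).2 ⟨?_, hr⟩⟩
      rw [List.length_drop]; omega
    · rintro ⟨i, hi⟩
      obtain ⟨h1, h2⟩ := (startM_iff _ (h.sublist (List.drop_sublist _ _))).1 hi
      rw [List.length_drop] at h1
      exact ⟨i, 3, by omega, by omega, h2⟩
  rw [key]
  clear key h
  induction l with
  | nil => simp [startM, badL]
  | cons a l ih =>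
    rw [badL.eq_2, ← propext ih]
    constructor
    · rintro ⟨i, hi⟩
      cases i with
      | zero => exact Or.inl hi
      | succ i => exact Or.inr ⟨i, hi⟩
    · rintro (hi | ⟨i, hi⟩)
      · exact ⟨0, hi⟩
      · exact ⟨i + 1, hi⟩

open scoped Classical in
noncomputable def wt (l : List ℕ) : ℚ[X] :=
  if l = [] then 1 else if badL l then 0 else X ^ (1 + desL l)

open scoped Classical in
noncomputable def gw (l : List ℕ) : ℚ[X] :=
  if badL l ∨ downUp l then 0 else X ^ (1 + desL l)

theorem desL_cons (m a : ℕ) (l : List ℕ) :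
    desL (m :: a :: l) = (if a < m then 1 else 0) + desL (a :: l) := by
  simp [desL, List.countP_cons, add_comm]

theorem desL_cons_min (m : ℕ) (l : List ℕ) (h : ∀ x ∈ l, m < x) : desL (m :: l) = desL l := by
  cases l with
  | nil => simp [desL]
  | cons a l =>
    have := h a (by simp)
    rw [desL_cons, if_neg (by omega), zero_add]

theorem desL_append (m : ℕ) (α γ : List ℕ) (h0 : α ≠ []) (h1 : ∀ x ∈ α, m < x)
    (h2 : ∀ x ∈ γ, m < x) : desL (α ++ m :: γ) = desL α + 1 + desL γ := by
  induction α with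
  | nil => exact absurd rfl h0
  | cons a α ih =>
    cases α with
    | nil =>
      have := h1 a (by simp)
      rw [List.singleton_append, desL_cons, desL_cons_min m γ h2, if_pos this]
      simp [desL]
    | cons b α =>
      have := ih (by simp) (fun x hx => h1 x (by simp at hx ⊢; tauto))
      rw [List.cons_append, List.cons_append, desL_cons, ← List.cons_append, this, desL_cons]
      omega

theorem badL_append (m : ℕ) (α γ : List ℕ) (h1 : ∀ x ∈ α, m < x) :
    badL (α ++ m :: γ) ↔ badL α ∨ badL (m :: γ) := by
  induction α with
  | nil => simp [badL]
  | cons a α ih =>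
    have ih := ih (fun x hx => h1 x (by simp [hx]))
    have hs : startM (a :: α ++ m :: γ) ↔ startM (a :: α) := by
      match α with
      | [] =>
        have := h1 a (by simp)
        match γ with
        | [] => simp [startM]
        | [_] => simp [startM]
        | _ :: _ :: _ => simp [startM]; omega
      | [b] =>
        have := h1 a (by simp)
        match γ with
        | [] => simp [startM]
        | _ :: _ => simp [startM]; omega
      | [b, c] =>
        have := h1 c (by simp)
        simp [startM]; omega
      | b :: c :: d :: _ => simp [startM]
    rw [List.cons_append, badL, ih, ← List.cons_append, hs, badL.eq_2 a α, or_assoc]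

theorem badL_cons_min (m : ℕ) (γ : List ℕ) (h2 : ∀ x ∈ γ, m < x) :
    badL (m :: γ) ↔ badL γ ∨ downUp γ := by
  rw [badL, or_comm]
  match γ with
  | [] => simp [startM, downUp]
  | [_] => simp [startM, downUp]
  | [_, _] => simp [startM, downUp]
  | a :: b :: c :: _ =>
    have := h2 b (by simp)
    simp [startM, downUp, this]

theorem wt_append (m : ℕ) (α γ : List ℕ) (h1 : ∀ x ∈ α, m < x)
    (h2 : ∀ x ∈ γ, m < x) : wt (α ++ m :: γ) = wt α * gw γ := by
  unfold wt gw
  rw [if_neg (by simp)]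
  rw [propext (badL_append m α γ h1), propext (badL_cons_min m γ h2)]
  by_cases h0 : α = []
  · subst h0
    by_cases hg : badL γ ∨ downUp γ <;> simp [badL, desL_cons_min m γ h2, hg]
  · rw [if_neg h0, desL_append m α γ h0 h1 h2]
    by_cases ha : badL α
    · simp [ha]
    · by_cases hg : badL γ ∨ downUp γ
      · simp [ha, hg]
      · simp only [ha, hg, or_self, if_false]; ring

theorem gw_append (m : ℕ) (α γ : List ℕ) (h1 : ∀ x ∈ α, m < x)
    (h2 : ∀ x ∈ γ, m < x) : gw (α ++ m :: γ) =
      if α.length = 0 then gw γ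
      else if α.length = 1 then (if γ.length = 0 then X ^ 2 else 0)
      else gw α * gw γ := by
  match α with
  | [] =>
    unfold gw
    have : ¬ downUp (m :: γ) := by
      match γ with
      | [] => simp [downUp]
      | [_] => simp [downUp]
      | a :: b :: _ =>
        have := h2 a (by simp)
        simp [downUp]; omega
    rw [List.nil_append, propext (badL_cons_min m γ h2), desL_cons_min m γ h2]
    by_cases hg : badL γ ∨ downUp γ <;> simp [this, hg]
  | [a] =>
    have ha := h1 a (by simp)
    match γ with
    | [] => simp [gw, badL, startM, downUp, desL, ha]
    | b :: γ =>
      have hb := h2 b (by simp)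
      simp [gw, downUp, ha, hb]
  | a :: b :: α =>
    rw [if_neg (by simp), if_neg (by simp)]
    unfold gw
    have hd : downUp (a :: b :: α ++ m :: γ) ↔ downUp (a :: b :: α) := by
      match α with
      | [] =>
        have := h1 b (by simp)
        simp [downUp]; omega
      | _ :: _ => simp [downUp]
    rw [desL_append m _ γ (by simp) h1 h2]
    rw [propext hd, propext (badL_append m _ γ h1), propext (badL_cons_min m γ h2)]
    by_cases hg : badL γ ∨ downUp γ
    · simp [hg]
    · by_cases ha : badL (a :: b :: α) ∨ downUp (a :: b :: α)
      · rw [if_pos (by tauto), if_pos ha, zero_mul]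
      · rw [if_neg (by tauto), if_neg ha, if_neg hg]; ring

/-- Lists enumerating `S`. -/
noncomputable def LL (S : Finset ℕ) : Finset (List ℕ) := S.toList.permutations.toFinset

theorem mem_LL (S : Finset ℕ) (l : List ℕ) : l ∈ LL S ↔ l.Nodup ∧ l.toFinset = S := by
  unfold LL
  rw [List.mem_toFinset, List.mem_permutations]
  constructor
  · intro hp
    exact ⟨hp.nodup_iff.2 S.nodup_toList, by
      rw [List.toFinset_eq_of_perm _ _ hp, Finset.toList_toFinset]⟩
  · rintro ⟨h1, h2⟩
    exact List.perm_of_nodup_nodup_toFinset_eq h1 S.nodup_toList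
      (by rw [h2, Finset.toList_toFinset])

theorem sum_LL_inv (S : Finset ℕ) (F : List ℕ → ℚ[X])
    (hF : ∀ (f : ℕ → ℕ) (l : List ℕ), (∀ x ∈ l, ∀ y ∈ l, (f x < f y ↔ x < y)) →
      F (l.map f) = F l) :
    ∑ l ∈ LL S, F l = ∑ l ∈ LL (Finset.range S.card), F l := by
  set f : ℕ → ℕ := fun x => (S.filter (· < x)).card with hf
  have hlt : ∀ x ∈ S, ∀ y, x < y → f x < f y := by
    intro x hx y hxy
    apply Finset.card_lt_card
    rw [Finset.ssubset_iff_of_subset]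
    · exact ⟨x, by simp [hx, hxy], by simp⟩
    · intro z hz
      simp at hz ⊢
      exact ⟨hz.1, by omega⟩
  have hiff : ∀ x ∈ S, ∀ y ∈ S, (f x < f y ↔ x < y) := by
    intro x hx y hy
    refine ⟨fun h => ?_, hlt x hx y⟩
    by_contra hc
    rcases Nat.lt_or_eq_of_le (not_lt.1 hc) with h' | h'
    · have := hlt y hy x h'; omega
    · subst h'; omega
  have hinj : Set.InjOn f S := by
    intro x hx y hy hxy
    by_contra hc
    rcases lt_or_gt_of_ne hc with h | h
    · have := hlt x hx y h; omega
    · have := hlt y hy x h; omega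
  have himg : S.image f = Finset.range S.card := by
    apply Finset.eq_of_subset_of_card_le
    · intro z hz
      simp only [Finset.mem_image] at hz
      obtain ⟨x, hx, rfl⟩ := hz
      rw [Finset.mem_range]
      apply Finset.card_lt_card
      rw [Finset.ssubset_iff_of_subset (Finset.filter_subset _ _)]
      exact ⟨x, hx, by simp⟩
    · rw [Finset.card_image_of_injOn hinj, Finset.card_range]
  have hmem : ∀ l ∈ LL S, ∀ x ∈ l, x ∈ S := by
    intro l hl x hx
    rw [← ((mem_LL _ _).1 hl).2]; simpa using hx
  refine Finset.sum_nbij (fun l => l.map f) ?_ ?_ ?_ ?_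
  · intro l hl
    have hl' := (mem_LL _ _).1 hl
    rw [mem_LL]
    refine ⟨hl'.1.map_on (fun x hx y hy h => hinj (hmem l hl x hx) (hmem l hl y hy) h), ?_⟩
    rw [← himg, ← hl'.2]
    ext z; simp
  · intro l hl l' hl' h
    have h1 := hmem l hl
    have h2 := hmem l' hl'
    clear hl hl'
    induction l generalizing l' with
    | nil => cases l' <;> simp_all
    | cons a l ih =>
      cases l' with
      | nil => simp at h
      | cons b l' =>
        simp only [List.map_cons, List.cons.injEq] at h
        rw [hinj (h1 a (by simp)) (h2 b (by simp)) h.1,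
          ih h.2 (fun x hx => h1 x (by simp [hx])) (fun x hx => h2 x (by simp [hx]))]
  · intro l hl
    have hl' := (mem_LL _ _).1 hl
    have hsub : ∀ x ∈ l, ∃ y ∈ S, f y = x := by
      intro x hx
      have : x ∈ S.image f := by rw [himg, ← hl'.2]; simpa using hx
      simpa using this
    have : ∃ k : List ℕ, (∀ x ∈ k, x ∈ S) ∧ k.map f = l := by
      clear hl hl'
      induction l with
      | nil => exact ⟨[], by simp⟩
      | cons a l ih =>
        obtain ⟨k, hk, rfl⟩ := ih (fun x hx => hsub x (by simp [hx]))
        obtain ⟨y, hy, rfl⟩ := hsub a (by simp)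
        exact ⟨y :: k, by simp [hy]; exact hk, rfl⟩
    obtain ⟨k, hk, rfl⟩ := this
    refine ⟨k, ?_, rfl⟩
    rw [Finset.mem_coe, mem_LL]
    have hkn : k.Nodup := List.Nodup.of_map f hl'.1
    refine ⟨hkn, Finset.eq_of_subset_of_card_le (fun x hx => hk x (by simpa using hx)) ?_⟩
    rw [List.toFinset_card_of_nodup hkn, ← List.length_map (f := f),
      ← List.toFinset_card_of_nodup hl'.1, hl'.2, Finset.card_range]
  · intro l hl
    exact (hF f l (fun x hx y hy => hiff x (hmem l hl x hx) y (hmem l hl y hy))).symm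

theorem startM_map (f : ℕ → ℕ) (l : List ℕ) (h : ∀ x ∈ l, ∀ y ∈ l, (f x < f y ↔ x < y)) :
    startM (l.map f) ↔ startM l := by
  match l with
  | [] => simp [startM]
  | [_] => simp [startM]
  | [_, _] => simp [startM]
  | [_, _, _] => simp [startM]
  | a :: b :: c :: d :: l =>
    simp only [List.map_cons, startM]
    rw [h a (by simp) c (by simp), h c (by simp) b (by simp), h c (by simp) d (by simp)]

theorem downUp_map (f : ℕ → ℕ) (l : List ℕ) (h : ∀ x ∈ l, ∀ y ∈ l, (f x < f y ↔ x < y)) :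
    downUp (l.map f) ↔ downUp l := by
  match l with
  | [] => simp [downUp]
  | [_] => simp [downUp]
  | [_, _] => simp [downUp]
  | a :: b :: c :: l =>
    simp only [List.map_cons, downUp]
    rw [h b (by simp) a (by simp), h b (by simp) c (by simp)]

theorem badL_map (f : ℕ → ℕ) (l : List ℕ) (h : ∀ x ∈ l, ∀ y ∈ l, (f x < f y ↔ x < y)) :
    badL (l.map f) ↔ badL l := by
  induction l with
  | nil => simp
  | cons a l ih =>
    have h1 := startM_map f _ h
    have h2 := ih (fun x hx y hy => h x (by simp [hx]) y (by simp [hy]))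
    rw [List.map_cons, badL, h2, ← List.map_cons, h1, badL]

theorem desL_map (f : ℕ → ℕ) (l : List ℕ) (h : ∀ x ∈ l, ∀ y ∈ l, (f x < f y ↔ x < y)) :
    desL (l.map f) = desL l := by
  induction l with
  | nil => simp
  | cons a l ih =>
    have h2 := ih (fun x hx y hy => h x (by simp [hx]) y (by simp [hy]))
    cases l with
    | nil => simp [desL]
    | cons b l =>
      rw [List.map_cons, List.map_cons, desL_cons, ← List.map_cons, h2, desL_cons]
      simp only [h b (by simp) a (by simp)]

theorem wt_map (f : ℕ → ℕ) (l : List ℕ) (h : ∀ x ∈ l, ∀ y ∈ l, (f x < f y ↔ x < y)) :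
    wt (l.map f) = wt l := by
  unfold wt
  rw [propext (badL_map f l h), desL_map f l h]
  simp only [List.map_eq_nil_iff]

theorem gw_map (f : ℕ → ℕ) (l : List ℕ) (h : ∀ x ∈ l, ∀ y ∈ l, (f x < f y ↔ x < y)) :
    gw (l.map f) = gw l := by
  unfold gw
  rw [propext (badL_map f l h), desL_map f l h, propext (downUp_map f l h)]

noncomputable def ww (n : ℕ) : ℚ[X] := ∑ l ∈ LL (Finset.range n), wt l
noncomputable def gg (n : ℕ) : ℚ[X] := ∑ l ∈ LL (Finset.range n), gw l

theorem sum_wt (S : Finset ℕ) : ∑ l ∈ LL S, wt l = ww S.card := sum_LL_inv S wt wt_map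
theorem sum_gw (S : Finset ℕ) : ∑ l ∈ LL S, gw l = gg S.card := sum_LL_inv S gw gw_map

theorem decomp (m : ℕ) (S : Finset ℕ) (hm : m ∉ S) (F : List ℕ → ℚ[X]) :
    ∑ l ∈ LL (insert m S), F l =
      ∑ A ∈ S.powerset, ∑ α ∈ LL A, ∑ γ ∈ LL (S \ A), F (α ++ m :: γ) := by
  have : ∀ A : Finset ℕ, ∑ α ∈ LL A, ∑ γ ∈ LL (S \ A), F (α ++ m :: γ) =
      ∑ p ∈ LL A ×ˢ LL (S \ A), F (p.1 ++ m :: p.2) := by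
    intro A; rw [Finset.sum_product]
  simp only [this]
  rw [Finset.sum_sigma']
  symm
  refine Finset.sum_nbij (fun q => q.2.1 ++ m :: q.2.2) ?_ ?_ ?_ ?_
  · rintro ⟨A, α, γ⟩ h
    simp only [Finset.mem_sigma, Finset.mem_powerset, Finset.mem_product, mem_LL] at h ⊢
    obtain ⟨hA, ⟨hα, rfl⟩, hγ, hγ'⟩ := h
    have hg : ∀ x, x ∈ γ ↔ x ∈ S ∧ x ∉ α := by
      intro x
      rw [← List.mem_toFinset, hγ']; simp
    have ha : ∀ x ∈ α, x ∈ S := fun x hx => hA (by simpa using hx)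
    constructor
    · rw [List.nodup_append]
      refine ⟨hα, List.nodup_cons.2 ⟨fun h => hm ((hg m).1 h).1, hγ⟩, ?_⟩
      intro x hx y hy hxy
      subst hxy
      rcases List.mem_cons.1 hy with rfl | hy
      · exact hm (ha _ hx)
      · exact ((hg x).1 hy).2 hx
    · ext x
      have := hg x
      have := ha x
      simp only [List.mem_toFinset, List.mem_append, List.mem_cons, Finset.mem_insert]
      tauto
  · rintro ⟨A, α, γ⟩ h ⟨A', α', γ'⟩ h' heq
    simp only [Finset.coe_sigma, Set.mem_sigma_iff, Finset.mem_coe, Finset.mem_powerset,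
      Finset.mem_product, mem_LL] at h h'
    obtain ⟨hA, ⟨hα, rfl⟩, hγ, hγ'⟩ := h
    obtain ⟨hA2, ⟨hα2, rfl⟩, hγ2, hγ2'⟩ := h'
    have n1 : m ∉ α := fun h => hm (hA (by simpa using h))
    have n2 : m ∉ α' := fun h => hm (hA2 (by simpa using h))
    have n3 : m ∉ γ := fun h => by
      rw [← List.mem_toFinset, hγ'] at h; exact hm (Finset.mem_sdiff.1 h).1
    have n4 : m ∉ γ' := fun h => by
      rw [← List.mem_toFinset, hγ2'] at h; exact hm (Finset.mem_sdiff.1 h).1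
    have key : α = α' ∧ γ = γ' := by
      simp only at heq
      clear hA hA2 hα hα2 hγ hγ2 hγ' hγ2'
      induction α generalizing α' with
      | nil =>
        cases α' with
        | nil => simpa using heq
        | cons b α' =>
          simp only [List.cons_append, List.nil_append, List.cons.injEq] at heq
          exact absurd (by simp [heq.1]) n2
      | cons a α ih =>
        cases α' with
        | nil =>
          simp only [List.cons_append, List.nil_append, List.cons.injEq] at heq
          exact absurd (by simp [heq.1]) n1
        | cons b α' =>
          simp only [List.cons_append, List.cons.injEq] at heq
          have := ih α' heq.2 (fun h => n1 (by simp [h])) (fun h => n2 (by simp [h]))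
          simp [heq.1, this.1, this.2]
    obtain ⟨rfl, rfl⟩ := key
    rfl
  · intro l hl
    rw [Finset.mem_coe, mem_LL] at hl
    obtain ⟨hn, hS⟩ := hl
    have hml : m ∈ l := by rw [← List.mem_toFinset, hS]; simp
    obtain ⟨α, γ, rfl⟩ := List.append_of_mem hml
    refine ⟨⟨α.toFinset, α, γ⟩, ?_, rfl⟩
    simp only [Finset.coe_sigma, Set.mem_sigma_iff, Finset.mem_coe, Finset.mem_powerset,
      Finset.mem_product, mem_LL]
    rw [List.nodup_append, List.nodup_cons] at hn
    obtain ⟨h1, ⟨h2, h3⟩, h4⟩ := hn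
    have hmem : ∀ x, (x ∈ α ∨ x = m ∨ x ∈ γ) ↔ (x = m ∨ x ∈ S) := by
      intro x
      have := congrArg (fun T => x ∈ T) hS
      simp only [List.mem_toFinset, List.mem_append, List.mem_cons, Finset.mem_insert] at this
      rw [this]
    have hma : m ∉ α := fun h => h4 m h m (by simp) rfl
    have hag : ∀ x ∈ α, x ∉ γ := fun x hx hx' => h4 x hx x (by simp [hx']) rfl
    refine ⟨?_, ⟨h1, trivial⟩, h3, ?_⟩
    · intro x hx
      rw [List.mem_toFinset] at hx
      have hne : x ≠ m := fun h => hma (h ▸ hx)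
      have := hmem x
      tauto
    · ext x
      rw [Finset.mem_sdiff, List.mem_toFinset, List.mem_toFinset]
      have h5 := hmem x
      have h6 := hag x
      by_cases hx : x = m
      · subst hx; tauto
      · tauto
  · intro q _; rfl

theorem range_insert (n : ℕ) : ∃ S : Finset ℕ, S.card = n ∧ (∀ x ∈ S, 0 < x) ∧ 
    Finset.range (n + 1) = insert 0 S := by
  refine ⟨(Finset.range (n + 1)).erase 0, ?_, ?_, ?_⟩
  · rw [Finset.card_erase_of_mem (by simp)]; simp
  · intro x hx; have := (Finset.mem_erase.1 hx).1; omega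
  · rw [Finset.insert_erase (by simp)]

theorem mem_of_LL {S : Finset ℕ} {l : List ℕ} (h : l ∈ LL S) {x : ℕ} (hx : x ∈ l) : x ∈ S := by
  rw [← ((mem_LL _ _).1 h).2]; simpa using hx

theorem len_of_LL {S : Finset ℕ} {l : List ℕ} (h : l ∈ LL S) : l.length = S.card := by
  have := (mem_LL _ _).1 h
  rw [← this.2, List.toFinset_card_of_nodup this.1]

theorem LL_empty : LL ∅ = {[]} := by
  ext l
  rw [mem_LL]
  simp only [List.toFinset_eq_empty_iff, Finset.mem_singleton]
  constructor
  · exact fun h => h.2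
  · rintro rfl; simp

theorem LL_single (a : ℕ) : LL {a} = {[a]} := by
  ext l
  rw [Finset.mem_singleton]
  constructor
  · intro h
    have h1 := len_of_LL h
    rw [Finset.card_singleton, List.length_eq_one_iff] at h1
    obtain ⟨b, rfl⟩ := h1
    have := mem_of_LL h (x := b) (by simp)
    simp at this
    rw [this]
  · rintro rfl; rw [mem_LL]; simp

theorem ww_zero : ww 0 = 1 := by simp [ww, LL_empty, wt]
theorem gg_zero : gg 0 = X := by simp [gg, LL_empty, gw, badL, downUp, desL]
theorem gg_one : gg 1 = X := by simp [gg, LL_single, gw, badL, startM, downUp, desL]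

theorem ww_succ (n : ℕ) :
    ww (n + 1) = ∑ k ∈ Finset.range (n + 1), n.choose k • (ww k * gg (n - k)) := by
  obtain ⟨S, hc, hp, hr⟩ := range_insert n
  have h0 : 0 ∉ S := fun h => lt_irrefl _ (hp 0 h)
  have := Finset.sum_powerset_apply_card (fun k => ww k * gg (n - k)) (x := S)
  rw [hc] at this
  rw [← this, ww, hr, decomp 0 S h0]
  refine Finset.sum_congr rfl fun A hA => ?_
  rw [Finset.mem_powerset] at hA
  have h2 : (S \ A).card = n - A.card := by rw [Finset.card_sdiff_of_subset hA, hc]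
  rw [← h2, ← sum_wt, ← sum_gw, Finset.sum_mul_sum]
  refine Finset.sum_congr rfl fun α hα => Finset.sum_congr rfl fun γ hγ => ?_
  exact wt_append 0 α γ (fun x hx => hp x (hA (mem_of_LL hα hx)))
    (fun x hx => hp x (Finset.mem_sdiff.1 (mem_of_LL hγ hx)).1)

noncomputable def hh (k j : ℕ) : ℚ[X] :=
  if k = 0 then gg j else if k = 1 then (if j = 0 then X ^ 2 else 0) else gg k * gg j

theorem gg_succ (n : ℕ) :
    gg (n + 1) = ∑ k ∈ Finset.range (n + 1), n.choose k • hh k (n - k) := by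
  obtain ⟨S, hc, hp, hr⟩ := range_insert n
  have h0 : 0 ∉ S := fun h => lt_irrefl _ (hp 0 h)
  have := Finset.sum_powerset_apply_card (fun k => hh k (n - k)) (x := S)
  rw [hc] at this
  rw [← this, gg, hr, decomp 0 S h0]
  refine Finset.sum_congr rfl fun A hA => ?_
  rw [Finset.mem_powerset] at hA
  have h2 : (S \ A).card = n - A.card := by rw [Finset.card_sdiff_of_subset hA, hc]
  have h3 : ∑ α ∈ LL A, ∑ γ ∈ LL (S \ A), gw (α ++ 0 :: γ) = 
      ∑ α ∈ LL A, ∑ γ ∈ LL (S \ A), if A.card = 0 then gw γ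
      else if A.card = 1 then (if (S \ A).card = 0 then X ^ 2 else 0)
      else gw α * gw γ := by
    refine Finset.sum_congr rfl fun α hα => Finset.sum_congr rfl fun γ hγ => ?_
    rw [← len_of_LL hα, ← len_of_LL hγ]
    exact gw_append 0 α γ (fun x hx => hp x (hA (mem_of_LL hα hx)))
      (fun x hx => hp x (Finset.mem_sdiff.1 (mem_of_LL hγ hx)).1)
  rw [h3, ← h2, hh]
  by_cases c0 : A.card = 0
  · simp only [c0, if_true]
    rw [Finset.card_eq_zero] at c0
    subst c0
    rw [LL_empty, Finset.sum_singleton, sum_gw]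
  by_cases c1 : A.card = 1
  · simp only [c1, if_true, one_ne_zero, if_false]
    obtain ⟨a, rfl⟩ := Finset.card_eq_one.1 c1
    rw [LL_single, Finset.sum_singleton]
    by_cases c2 : (S \ {a}).card = 0
    · simp only [c2, if_true]
      rw [Finset.card_eq_zero] at c2
      rw [c2, LL_empty, Finset.sum_singleton]
    · simp [c2]
  · simp only [c0, c1, if_false]
    rw [← sum_gw, ← sum_gw, Finset.sum_mul_sum]

theorem NM_eq (n : ℕ) : NMpoly {[1, 3, 2, 4], [1, 4, 2, 3]} n = ww n := by
  unfold NMpoly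
  split_ifs with h
  · rw [h, ww_zero]
  have hc : (List.range' 1 n).toFinset.card = n := by
    rw [List.toFinset_card_of_nodup List.nodup_range', List.length_range']
  conv_rhs => rw [← hc, ← sum_wt]
  unfold NMfinset
  rw [Finset.sum_filter]
  have hL : (List.range' 1 n).permutations.toFinset = LL (List.range' 1 n).toFinset := by
    ext l
    rw [List.mem_toFinset, List.mem_permutations, mem_LL]
    constructor
    · intro hp
      exact ⟨hp.nodup_iff.2 List.nodup_range', List.toFinset_eq_of_perm _ _ hp⟩
    · rintro ⟨h1, h2⟩
      exact List.perm_of_nodup_nodup_toFinset_eq h1 List.nodup_range' h2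
  rw [hL]
  refine Finset.sum_congr rfl fun l hl => ?_
  have hlen := len_of_LL hl
  rw [hc] at hlen
  have hne : l ≠ [] := by rintro rfl; simp at hlen; omega
  have := hasMatch_iff l ((mem_LL _ _).1 hl).1
  unfold wt
  rw [if_neg hne]
  rw [propext this]
  by_cases hb : badL l <;> simp [hb]

noncomputable def egf (a : ℕ → ℚ[X]) : PowerSeries ℚ[X] :=
  PowerSeries.mk (fun n => C (1 / (n.factorial : ℚ)) * a n)

theorem egf_coeff (a : ℕ → ℚ[X]) (n : ℕ) :
    PowerSeries.coeff n (egf a) = C (1 / (n.factorial : ℚ)) * a n := by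
  rw [egf, PowerSeries.coeff_mk]

theorem egf_inj {a b : ℕ → ℚ[X]} (h : egf a = egf b) (n : ℕ) : a n = b n := by
  have := congrArg (PowerSeries.coeff n) h
  rw [egf_coeff, egf_coeff] at this
  refine mul_left_cancel₀ ?_ this
  rw [Ne, C_eq_zero]
  have := n.factorial_ne_zero
  positivity

theorem egf_mul (a b : ℕ → ℚ[X]) : egf a * egf b =
    egf (fun n => ∑ k ∈ Finset.range (n + 1), n.choose k • (a k * b (n - k))) := by
  ext1 n
  rw [PowerSeries.coeff_mul, egf_coeff, Finset.Nat.sum_antidiagonal_eq_sum_range_succ_mk,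
    Finset.mul_sum]
  refine Finset.sum_congr rfl fun k hk => ?_
  have hk : k ≤ n := by rw [Finset.mem_range] at hk; omega
  rw [egf_coeff, egf_coeff, nsmul_eq_mul, ← C_eq_natCast, Nat.cast_choose ℚ hk]
  have : (1 / (k.factorial : ℚ)) * (1 / ((n - k).factorial : ℚ)) = 
    (1 / (n.factorial : ℚ)) * (n.factorial / (k.factorial * (n - k).factorial)) := by
    have := n.factorial_ne_zero
    field_simp
  calc _ = C ((1 / (k.factorial : ℚ)) * (1 / ((n - k).factorial : ℚ))) * (a k * b (n - k)) := by
        rw [C_mul]; ring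
    _ = _ := by rw [this, C_mul]; ring

theorem egf_deriv (a : ℕ → ℚ[X]) :
    PowerSeries.derivative ℚ[X] (egf a) = egf (fun n => a (n + 1)) := by
  ext1 n
  rw [PowerSeries.coeff_derivative, egf_coeff, egf_coeff, Nat.factorial_succ]
  have : ((n : ℚ[X]) + 1) = C ((n : ℚ) + 1) := by simp
  rw [this, mul_right_comm, ← C_mul]
  congr 2
  have := n.factorial_ne_zero
  push_cast
  field_simp

theorem egf_X (a : ℕ → ℚ[X]) :
    PowerSeries.X * egf a = egf (fun n => (n : ℚ[X]) * a (n - 1)) := by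
  ext1 n
  cases n with
  | zero => rw [egf_coeff]; simp
  | succ n =>
    rw [PowerSeries.coeff_succ_X_mul, egf_coeff, egf_coeff, Nat.factorial_succ,
      ← C_eq_natCast, ← mul_assoc, ← C_mul, Nat.add_sub_cancel]
    congr 2
    have := n.factorial_ne_zero
    push_cast
    field_simp

theorem egf_add (a b : ℕ → ℚ[X]) : egf a + egf b = egf (fun n => a n + b n) := by
  ext1 n; rw [map_add, egf_coeff, egf_coeff, egf_coeff]; ring

theorem egf_sub (a b : ℕ → ℚ[X]) : egf a - egf b = egf (fun n => a n - b n) := by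
  ext1 n; rw [map_sub, egf_coeff, egf_coeff, egf_coeff]; ring

theorem egf_C (c : ℚ[X]) (a : ℕ → ℚ[X]) : PowerSeries.C c * egf a = egf (fun n => c * a n) := by
  ext1 n; rw [PowerSeries.coeff_C_mul, egf_coeff, egf_coeff]; ring

theorem egf_one : egf (fun n => if n = 0 then 1 else 0) = 1 := by
  ext1 n; rw [egf_coeff, PowerSeries.coeff_one]
  split_ifs with h
  · simp [h]
  · simp

theorem gg_rec (n : ℕ) : gg (n + 1) =
    (∑ k ∈ Finset.range (n + 1), n.choose k • (gg k * gg (n - k))) + (1 - X) * gg n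
      - X * ((n : ℚ[X]) * gg (n - 1))
      + X ^ 2 * ((n : ℚ[X]) * (if n - 1 = 0 then 1 else 0)) := by
  have h : ∀ k j, hh k j = gg k * gg j + (if k = 0 then (1 - X) * gg j else 0)
      + (if k = 1 then X ^ 2 * (if j = 0 then 1 else 0) - X * gg j else 0) := by
    intro k j
    unfold hh
    by_cases h0 : k = 0
    · subst h0; simp [gg_zero]; ring
    · by_cases h1 : k = 1
      · subst h1; simp [gg_one]
      · simp [h0, h1]
  rw [gg_succ]
  simp only [h, smul_add, Finset.sum_add_distrib, smul_ite, smul_zero]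
  rw [Finset.sum_ite_eq', Finset.sum_ite_eq', if_pos (by simp)]
  cases n with
  | zero => simp
  | succ n =>
    rw [if_pos (by simp)]
    simp only [Nat.choose_zero_right, Nat.choose_one_right, nsmul_eq_mul, Nat.sub_zero]
    push_cast
    ring

theorem ode_G : PowerSeries.derivative ℚ[X] (egf gg) = egf gg * egf gg
    + PowerSeries.C (1 - X) * egf gg - PowerSeries.C X * (PowerSeries.X * egf gg)
    + PowerSeries.C (X ^ 2) * (PowerSeries.X * 1) := by
  rw [egf_deriv, ← egf_one, egf_mul, egf_C, egf_X, egf_X, egf_C, egf_C, egf_add, egf_sub, egf_add]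
  exact congrArg egf (funext gg_rec)

theorem ode_N : PowerSeries.derivative ℚ[X] (egf ww) = egf ww * egf gg := by
  rw [egf_deriv, egf_mul]
  exact congrArg egf (funext ww_succ)

theorem deriv_mul_ps {R : Type*} [CommRing R] (f g : PowerSeries R) :
    PowerSeries.derivative R (f * g) =
      f * PowerSeries.derivative R g + g * PowerSeries.derivative R f := by
  rw [Derivation.leibniz, smul_eq_mul, smul_eq_mul]

theorem ode_U (V : PowerSeries ℚ[X]) (hV : V * egf ww = 1) :
    PowerSeries.derivative ℚ[X] V = - (egf gg * V) ∧
    PowerSeries.derivative ℚ[X] (PowerSeries.derivative ℚ[X] V) =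
      PowerSeries.C (1 - X) * PowerSeries.derivative ℚ[X] V
      - PowerSeries.C X * (PowerSeries.X * PowerSeries.derivative ℚ[X] V)
      - PowerSeries.C (X ^ 2) * (PowerSeries.X * V) := by
  have h1 : PowerSeries.derivative ℚ[X] V = - (egf gg * V) := by
    have := congrArg (PowerSeries.derivative ℚ[X]) hV
    rw [deriv_mul_ps, ode_N, PowerSeries.derivative_one] at this
    linear_combination V * this - (PowerSeries.derivative ℚ[X] V + egf gg * V) * hV
  refine ⟨h1, ?_⟩
  rw [h1, map_neg, deriv_mul_ps, ode_G, h1]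
  ring

theorem stmt4 (Γ : Set (List ℕ)) (hΓ : Γ = {[1, 3, 2, 4], [1, 4, 2, 3]})
    (U : ℤ → Polynomial ℚ)
    (hUneg : ∀ m : ℤ, m < 0 → U m = 0)
    (hU0 : U 0 = 1)
    (hUrec : ∀ n : ℕ, 1 ≤ n →
      ∑ k ∈ Finset.range (n + 1), (n.choose k : ℚ) • (U (k : ℤ) * NMpoly Γ (n - k)) = 0) :
    U 1 = -X ∧ ∀ n : ℕ, 2 ≤ n →
      U (n : ℤ) = (1 - X) * U ((n : ℤ) - 1) -
        X * Polynomial.C ((n : ℚ) - 2) * (U ((n : ℤ) - 2) + X * U ((n : ℤ) - 3)) := by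
  subst hΓ
  simp only [NM_eq] at hUrec
  have hV : egf (fun n => U (n : ℤ)) * egf ww = 1 := by
    rw [egf_mul, ← egf_one]
    congr 1
    funext n
    split_ifs with h
    · subst h; simp [hU0, ww_zero]
    · rw [← hUrec n (by omega)]
      refine Finset.sum_congr rfl fun k _ => ?_
      rw [Nat.cast_smul_eq_nsmul]
  obtain ⟨h1, h2⟩ := ode_U _ hV
  have hU1 : U 1 = -X := by
    have := congrArg (PowerSeries.coeff 0) h1
    rw [egf_deriv, egf_mul, map_neg, egf_coeff, egf_coeff] at this
    simpa [hU0, gg_zero] using this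
  refine ⟨hU1, ?_⟩
  intro n hn
  obtain ⟨m, rfl⟩ : ∃ m, n = m + 2 := ⟨n - 2, by omega⟩
  rw [egf_deriv, egf_deriv, egf_C, egf_X, egf_C, egf_X, egf_C, egf_sub, egf_sub] at h2
  have h3 := egf_inj h2 m
  have e1 : ((m + 2 : ℕ) : ℤ) - 1 = ((m + 1 : ℕ) : ℤ) := by push_cast; ring
  have e2 : ((m + 2 : ℕ) : ℤ) - 2 = (m : ℤ) := by push_cast; ring
  have e4 : C (((m + 2 : ℕ) : ℚ) - 2) = (m : ℚ[X]) := by simp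
  rw [e1, e2, e4]
  cases m with
  | zero =>
    simp at h3 ⊢
    exact h3
  | succ m =>
    have e3 : ((m + 1 + 2 : ℕ) : ℤ) - 3 = (m : ℤ) := by push_cast; ring
    rw [e3]
    simp only [Nat.add_sub_cancel] at h3
    rw [h3]
    ring
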